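/- Let G be a vertex-minimal triangle-free, fork-free graph with chromatic number at least 4, and let C be a good 5-cycle in G. Then for every vertex x in N(C) (at distance exactly 1 from C), either x has at most one neighbor on C, or x has at most one neighbor among the vertices at distance exactly 2 from C. -/

import Mathlib

open SimpleGraph

/-- The fork: `K_{1,4}` with two edges subdivided. Vertex 0 is the center,
adjacent to leaves 1, 2 and to 3, 5; paths 0-3-4 and 0-5-6. -/
def fork : SimpleGraph (Fin 7) :=
  SimpleGraph.fromEdgeSet {s(0, 1), s(0, 2), s(0, 3), s(0, 5), s(3, 4), s(5, 6)}

/-- A graph is fork-free if it has no induced subgraph isomorphic to the fork. -/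
def ForkFree {V : Type} (G : SimpleGraph V) : Prop :=
  IsEmpty (fork ↪g G)

/-- `G` is a vertex-minimal triangle-free, fork-free graph with chromatic
number at least 4: every smaller triangle-free fork-free graph is 3-colorable. -/
def MinCex {V : Type} [Fintype V] (G : SimpleGraph V) : Prop :=
  G.CliqueFree 3 ∧ ForkFree G ∧ 4 ≤ G.chromaticNumber ∧
    ∀ (W : Type) [Fintype W] (H : SimpleGraph W),
      Fintype.card W < Fintype.card V → H.CliqueFree 3 → ForkFree H →
        H.chromaticNumber ≤ 3

/-- `c` describes a 5-cycle in `G`. -/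
def IsC5 {V : Type} (G : SimpleGraph V) (c : Fin 5 → V) : Prop :=
  Function.Injective c ∧ ∀ i : Fin 5, G.Adj (c i) (c (i + 1))

/-- Distance from a vertex `u` to the 5-cycle `c`. -/
noncomputable def distC {V : Type} (G : SimpleGraph V) (c : Fin 5 → V) (u : V) : ℕ :=
  Finset.univ.inf' Finset.univ_nonempty fun i => G.dist u (c i)

/-- A good 5-cycle: one minimizing the number of vertices at distance at least 2. -/
def GoodC5 {V : Type} (G : SimpleGraph V) (c : Fin 5 → V) : Prop :=
  IsC5 G c ∧ ∀ d : Fin 5 → V, IsC5 G d →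
    {u : V | 2 ≤ distC G c u}.ncard ≤ {u : V | 2 ≤ distC G d u}.ncard


/-- Triangle-free graphs: no three mutually adjacent vertices. -/
lemma tri_free {V : Type} {G : SimpleGraph V} (h : G.CliqueFree 3) {a b c : V}
    (h1 : G.Adj a b) (h2 : G.Adj b c) (h3 : G.Adj a c) : False := by
  classical
  exact h {a, b, c} (SimpleGraph.is3Clique_triple_iff.2 ⟨h1, h3, h2⟩)

/-- Fork lemma: center `a`, leaves `b₁ b₂`, legs `a-d₁-e₁`, `a-d₂-e₂`. -/
lemma fork_lemma {V : Type} {G : SimpleGraph V} (h : G.CliqueFree 3) (hf : ForkFree G)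
    {a b₁ b₂ d₁ e₁ d₂ e₂ : V} (hb : b₁ ≠ b₂)
    (ab1 : G.Adj a b₁) (ab2 : G.Adj a b₂) (ad1 : G.Adj a d₁) (ad2 : G.Adj a d₂)
    (de1 : G.Adj d₁ e₁) (de2 : G.Adj d₂ e₂)
    (n1 : ¬ G.Adj e₁ e₂) (n2 : ¬ G.Adj e₁ b₁) (n3 : ¬ G.Adj e₁ b₂) (n4 : ¬ G.Adj e₁ d₂)
    (n5 : ¬ G.Adj e₂ b₁) (n6 : ¬ G.Adj e₂ b₂) (n7 : ¬ G.Adj e₂ d₁) : False := by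
  have nb {u v : V} (hu : G.Adj a u) (hv : G.Adj a v) : ¬ G.Adj u v :=
    fun huv => tri_free h hu huv hv
  have m1 := nb ab1 ab2
  have m2 := nb ab1 ad1
  have m3 := nb ab1 ad2
  have m4 := nb ab2 ad1
  have m5 := nb ab2 ad2
  have m6 := nb ad1 ad2
  have m7 : ¬ G.Adj a e₁ := fun k => tri_free h ad1 de1 k
  have m8 : ¬ G.Adj a e₂ := fun k => tri_free h ad2 de2 k
  have key : ∀ i j : Fin 7, G.Adj (![a, b₁, b₂, d₁, e₁, d₂, e₂] i) (![a, b₁, b₂, d₁, e₁, d₂, e₂] j)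
      ↔ fork.Adj i j := by
    intro i j
    fin_cases i <;> fin_cases j <;> simp [fork, *, G.adj_comm] <;>
      simp_all [G.adj_comm]
  refine hf.false ⟨⟨![a, b₁, b₂, d₁, e₁, d₂, e₂], ?_⟩, ?_⟩
  · have s1 : a ≠ b₁ := ab1.ne
    have s2 : a ≠ b₂ := ab2.ne
    have s3 : a ≠ d₁ := ad1.ne
    have s4 : a ≠ d₂ := ad2.ne
    have s5 : d₁ ≠ e₁ := de1.ne
    have s6 : d₂ ≠ e₂ := de2.ne
    have s7 : a ≠ e₁ := by rintro rfl; exact n2 ab1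
    have s8 : a ≠ e₂ := by rintro rfl; exact n5 ab1
    have s9 : b₁ ≠ d₁ := by rintro rfl; exact n2 de1.symm
    have s10 : b₁ ≠ d₂ := by rintro rfl; exact n5 de2.symm
    have s11 : b₂ ≠ d₁ := by rintro rfl; exact n3 de1.symm
    have s12 : b₂ ≠ d₂ := by rintro rfl; exact n6 de2.symm
    have s13 : d₁ ≠ d₂ := by rintro rfl; exact n4 de1.symm
    have s14 : e₁ ≠ e₂ := by rintro rfl; exact n4 de2.symm
    have s15 : b₁ ≠ e₁ := by rintro rfl; exact m7 ab1
    have s16 : b₁ ≠ e₂ := by rintro rfl; exact m8 ab1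
    have s17 : b₂ ≠ e₁ := by rintro rfl; exact m7 ab2
    have s18 : b₂ ≠ e₂ := by rintro rfl; exact m8 ab2
    have s19 : d₁ ≠ e₂ := by rintro rfl; exact m8 ad1
    have s20 : d₂ ≠ e₁ := by rintro rfl; exact m7 ad2
    intro i j hij
    fin_cases i <;> fin_cases j <;> simp_all
  · intro i j
    exact key i j

/-- In a minimal counterexample no neighborhood is contained in another. -/
lemma no_dom {V : Type} [Fintype V] {G : SimpleGraph V} (hG : MinCex G) {u v : V}
    (huv : u ≠ v) : ∃ w, G.Adj u w ∧ ¬ G.Adj v w := by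
  classical
  by_contra! hcon
  obtain ⟨h3, hf, h4, hmin⟩ := hG
  have hcard : Fintype.card ({u}ᶜ : Set V) < Fintype.card V :=
    Fintype.card_subtype_lt (x := u) (by simp)
  have hc := hmin ({u}ᶜ : Set V) (G.induce {u}ᶜ) hcard
    (h3.comap ⟨(SimpleGraph.Embedding.induce _).toCopy⟩)
    ⟨fun e => hf.false (e.trans (SimpleGraph.Embedding.induce _))⟩
  have hcol : (G.induce ({u}ᶜ : Set V)).Colorable 3 :=
    SimpleGraph.chromaticNumber_le_iff_colorable.1 (by exact_mod_cast hc)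
  obtain ⟨C⟩ := hcol
  have : G.Colorable 3 := by
    refine ⟨SimpleGraph.Coloring.mk
      (fun w => if hw : w = u then C ⟨v, by simpa using huv.symm⟩ else C ⟨w, by simpa using hw⟩) ?_⟩
    intro a b hab
    by_cases ha : a = u
    · subst ha
      have hb : b ≠ a := hab.ne'
      simp only [dif_pos, dif_neg hb]
      exact C.valid (by simpa using hcon b hab)
    · by_cases hb : b = u
      · subst hb
        simp only [dif_pos, dif_neg ha]
        exact C.valid (by simpa using (hcon a hab.symm).symm)
      · simp only [dif_neg ha, dif_neg hb]
        exact C.valid (by simpa using hab)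
  have h5 : G.chromaticNumber ≤ 3 := by
    exact_mod_cast SimpleGraph.chromaticNumber_le_iff_colorable.2 this
  have h6 := h4.trans h5
  exact absurd h6 (by decide)

/-- Private neighbors of `y₁`, `y₂` : one of them is attached to `c0` and not to `c2`. -/
lemma side {V : Type} [Fintype V] {G : SimpleGraph V} (hG : MinCex G)
    {c0 c1 c2 c3 c4 x y₁ y₂ : V} (hy : y₁ ≠ y₂)
    (h01 : G.Adj c0 c1) (h12 : G.Adj c1 c2) (h23 : G.Adj c2 c3) (h34 : G.Adj c3 c4)
    (h40 : G.Adj c4 c0) (n14 : c1 ≠ c4) (n13 : c1 ≠ c3) (n02 : c0 ≠ c2)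
    (x0 : G.Adj x c0) (x2 : G.Adj x c2)
    (xy1 : G.Adj x y₁) (xy2 : G.Adj x y₂)
    (hy1 : ∀ v, v = c0 ∨ v = c1 ∨ v = c2 ∨ v = c3 ∨ v = c4 → ¬ G.Adj y₁ v)
    (hy2 : ∀ v, v = c0 ∨ v = c1 ∨ v = c2 ∨ v = c3 ∨ v = c4 → ¬ G.Adj y₂ v) :
    (∃ z, G.Adj y₁ z ∧ ¬ G.Adj y₂ z ∧ G.Adj z c0 ∧ ¬ G.Adj z c2) ∨
    (∃ z, G.Adj y₂ z ∧ ¬ G.Adj y₁ z ∧ G.Adj z c0 ∧ ¬ G.Adj z c2) := by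
  have T := @tri_free V G hG.1
  -- location of private neighbors
  have loc : ∀ y y' z : V, y ≠ y' → G.Adj x y → G.Adj x y' →
      (∀ v, v = c0 ∨ v = c1 ∨ v = c2 ∨ v = c3 ∨ v = c4 → ¬ G.Adj y v) →
      (∀ v, v = c0 ∨ v = c1 ∨ v = c2 ∨ v = c3 ∨ v = c4 → ¬ G.Adj y' v) →
      G.Adj y z → ¬ G.Adj y' z → G.Adj z c0 ∨ G.Adj z c2 := by
    intro y y' z hne xy xy' hy hy' yz y'z
    by_contra! hcon
    obtain ⟨k0, k2⟩ := hcon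
    have m4 : G.Adj c4 z := by
      by_contra k4
      refine fork_lemma hG.1 hG.2.1 (a := x) (b₁ := c2) (b₂ := y') (d₁ := c0) (e₁ := c4)
        (d₂ := y) (e₂ := z) ?_ x2 xy' x0 xy h40.symm yz k4 (fun k => T h23 h34 k.symm)
        (fun k => hy' _ (by simp) k.symm) (fun k => hy _ (by simp) k.symm)
        k2 (fun k => y'z k.symm) k0
      rintro rfl
      exact hy' c3 (by simp) h23
    have m3 : G.Adj c3 z := by
      by_contra k4
      refine fork_lemma hG.1 hG.2.1 (a := x) (b₁ := c0) (b₂ := y') (d₁ := c2) (e₁ := c3)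
        (d₂ := y) (e₂ := z) ?_ x0 xy' x2 xy h23 yz k4 (fun k => T h34 h40 k)
        (fun k => hy' _ (by simp) k.symm) (fun k => hy _ (by simp) k.symm)
        k0 (fun k => y'z k.symm) k2
      rintro rfl
      exact hy' c1 (by simp) h01
    exact T h34 m4 m3
  obtain ⟨z, yz, y'z⟩ := no_dom hG hy
  obtain ⟨w, yw, y'w⟩ := no_dom hG hy.symm
  have lz := loc y₁ y₂ z hy xy1 xy2 hy1 hy2 yz y'z
  have lw := loc y₂ y₁ w hy.symm xy2 xy1 hy2 hy1 yw y'w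
  have b0 : ¬ (G.Adj z c0 ∧ G.Adj w c0) := by
    rintro ⟨k1, k2⟩
    exact fork_lemma hG.1 hG.2.1 (a := c0) (b₁ := c1) (b₂ := c4) (d₁ := z) (e₁ := y₁)
      (d₂ := w) (e₂ := y₂) n14 h01 h40.symm k1.symm k2.symm yz.symm yw.symm
      (fun k => T xy1 k xy2) (hy1 _ (by simp)) (hy1 _ (by simp)) y'w
      (hy2 _ (by simp)) (hy2 _ (by simp)) y'z
  have b2 : ¬ (G.Adj z c2 ∧ G.Adj w c2) := by
    rintro ⟨k1, k2⟩
    exact fork_lemma hG.1 hG.2.1 (a := c2) (b₁ := c1) (b₂ := c3) (d₁ := z) (e₁ := y₁)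
      (d₂ := w) (e₂ := y₂) n13 h12.symm h23 k1.symm k2.symm yz.symm yw.symm
      (fun k => T xy1 k xy2) (hy1 _ (by simp)) (hy1 _ (by simp)) y'w
      (hy2 _ (by simp)) (hy2 _ (by simp)) y'z
  by_cases hz : G.Adj z c0
  · left
    exact ⟨z, yz, y'z, hz, by tauto⟩
  · right
    exact ⟨w, yw, y'w, by tauto, by tauto⟩

/-- The final contradiction, after labelling so that `z`, `w` are attached to `c0`. -/
lemma final {V : Type} {G : SimpleGraph V} (h : G.CliqueFree 3) (hf : ForkFree G)
    {c0 c1 c2 c3 c4 x y₁ y₂ p₁ p₂ z w : V} (hy : y₁ ≠ y₂) (hp : p₁ ≠ p₂)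
    (h01 : G.Adj c0 c1) (h12 : G.Adj c1 c2) (h23 : G.Adj c2 c3) (h34 : G.Adj c3 c4)
    (h40 : G.Adj c4 c0)
    (x0 : G.Adj x c0) (x2 : G.Adj x c2)
    (xy1 : G.Adj x y₁) (xy2 : G.Adj x y₂) (cp1 : G.Adj c1 p₁) (cp2 : G.Adj c1 p₂)
    (hy1 : ∀ v, v = c0 ∨ v = c1 ∨ v = c2 ∨ v = c3 ∨ v = c4 → ¬ G.Adj y₁ v)
    (hy2 : ∀ v, v = c0 ∨ v = c1 ∨ v = c2 ∨ v = c3 ∨ v = c4 → ¬ G.Adj y₂ v)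
    (hp1 : ∀ v, v = c0 ∨ v = x ∨ v = c2 ∨ v = c3 ∨ v = c4 → ¬ G.Adj p₁ v)
    (hp2 : ∀ v, v = c0 ∨ v = x ∨ v = c2 ∨ v = c3 ∨ v = c4 → ¬ G.Adj p₂ v)
    (yz : G.Adj y₁ z) (y'z : ¬ G.Adj y₂ z) (z0 : G.Adj z c0) (z2 : ¬ G.Adj z c2)
    (pw : G.Adj p₁ w) (p'w : ¬ G.Adj p₂ w) (w0 : G.Adj w c0) (w2 : ¬ G.Adj w c2) : False := by
  have T := @tri_free V G h
  -- `p` is complete or anticomplete to the `y`s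
  have py : ∀ p y y' : V, y ≠ y' → G.Adj x y → G.Adj x y' → ¬ G.Adj y c4 → ¬ G.Adj y' c4 →
      ¬ G.Adj y' c3 →
      (∀ v, v = c0 ∨ v = x ∨ v = c2 ∨ v = c3 ∨ v = c4 → ¬ G.Adj p v) →
      G.Adj p y → G.Adj p y' := by
    intro p y y' hne xy xy' ny ny' ny3 hp py
    by_contra k
    refine fork_lemma h hf (a := x) (b₁ := c2) (b₂ := y') (d₁ := c0) (e₁ := c4)
        (d₂ := y) (e₂ := p) ?_ x2 xy' x0 xy h40.symm py.symm
        (fun k => hp _ (by simp) k.symm) (fun k => T h23 h34 k.symm)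
        (fun k => ny' k.symm) (fun k => ny k.symm)
        (hp _ (by simp)) k (hp _ (by simp))
    rintro rfl
    exact ny3 h23
  have yp : ∀ p p' y : V, p ≠ p' → G.Adj c1 p → G.Adj c1 p' → ¬ G.Adj p c4 → ¬ G.Adj p' c4 →
      ¬ G.Adj p' c3 →
      (∀ v, v = c0 ∨ v = c1 ∨ v = c2 ∨ v = c3 ∨ v = c4 → ¬ G.Adj y v) →
      G.Adj y p → G.Adj y p' := by
    intro p p' y hne xy xy' ny ny' ny3 hp py
    by_contra k
    refine fork_lemma h hf (a := c1) (b₁ := c2) (b₂ := p') (d₁ := c0) (e₁ := c4)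
        (d₂ := p) (e₂ := y) ?_ h12 xy' h01.symm xy h40.symm py.symm
        (fun k => hp _ (by simp) k.symm) (fun k => T h23 h34 k.symm)
        (fun k => ny' k.symm) (fun k => ny k.symm)
        (hp _ (by simp)) k (hp _ (by simp))
    rintro rfl
    exact ny3 h23
  by_cases hc : G.Adj p₂ y₂
  · have e1 : G.Adj p₂ y₁ := py p₂ y₂ y₁ hy.symm xy2 xy1 (hy2 _ (by simp)) (hy1 _ (by simp))
      (hy1 _ (by simp)) hp2 hc
    have e2 : G.Adj y₁ p₁ := yp p₂ p₁ y₁ hp.symm cp2 cp1 (hp2 _ (by simp)) (hp1 _ (by simp))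
      (hp1 _ (by simp)) hy1 e1.symm
    refine fork_lemma h hf (a := y₁) (b₁ := z) (b₂ := p₂) (d₁ := x) (e₁ := c2)
      (d₂ := p₁) (e₂ := w) ?_ yz e1.symm xy1.symm e2 x2 pw
      (fun k => w2 k.symm) (fun k => z2 k.symm) (fun k => hp2 _ (by simp) k.symm)
      (fun k => hp1 _ (by simp) k.symm) (fun k => T k z0 w0) (fun k => p'w k.symm)
      (fun k => T k x0 w0)
    rintro rfl
    exact hp2 _ (by simp) z0
  · have wy : G.Adj w y₂ := by
      by_contra k
      refine fork_lemma h hf (a := c0) (b₁ := c4) (b₂ := w) (d₁ := c1) (e₁ := p₂)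
        (d₂ := x) (e₂ := y₂) ?_ h40.symm w0.symm h01 x0.symm cp2 xy2 hc
        (hp2 _ (by simp)) p'w (hp2 _ (by simp)) (hy2 _ (by simp)) (fun l => k l.symm)
        (hy2 _ (by simp))
      rintro rfl
      exact hp1 _ (by simp) pw
    refine fork_lemma h hf (a := c0) (b₁ := c4) (b₂ := z) (d₁ := c1) (e₁ := c2)
      (d₂ := w) (e₂ := y₂) ?_ h40.symm z0.symm h01 w0.symm h12 wy
      (fun k => hy2 _ (by simp) k.symm) (fun k => T h23 h34 k) (fun k => z2 k.symm)
      (fun k => w2 k.symm) (hy2 _ (by simp)) y'z (hy2 _ (by simp))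
    rintro rfl
    exact hy1 _ (by simp) yz

lemma distC_le {V : Type} {G : SimpleGraph V} {c : Fin 5 → V} (u : V) (i : Fin 5) :
    distC G c u ≤ G.dist u (c i) :=
  Finset.inf'_le _ (Finset.mem_univ i)

lemma distC_exists {V : Type} {G : SimpleGraph V} (c : Fin 5 → V) (u : V) :
    ∃ i, distC G c u = G.dist u (c i) := by
  obtain ⟨i, -, hi⟩ := Finset.exists_mem_eq_inf' (Finset.univ_nonempty (α := Fin 5))
    (fun i => G.dist u (c i))
  exact ⟨i, hi⟩

lemma not_adj_of_distC {V : Type} {G : SimpleGraph V} {c : Fin 5 → V} {u : V}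
    (h : 2 ≤ distC G c u) (i : Fin 5) : ¬ G.Adj u (c i) := by
  intro k
  have h1 := distC_le (G := G) (c := c) u i
  rw [SimpleGraph.dist_eq_one_iff_adj.2 k] at h1
  omega

theorem minCex_no_degree2_both_sides {V : Type} [Fintype V]
    (G : SimpleGraph V) (hG : MinCex G) (c : Fin 5 → V) (hc : GoodC5 G c)
    (x : V) (hx : distC G c x = 1) :
    {y : V | y ∈ Set.range c ∧ G.Adj x y}.ncard ≤ 1 ∨
      {y : V | distC G c y = 2 ∧ G.Adj x y}.ncard ≤ 1 := by
  classical
  by_contra! hcon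
  obtain ⟨hA, hB⟩ := hcon
  obtain ⟨⟨cinj, cadj⟩, hgood⟩ := hc
  have T := @tri_free V G hG.1
  obtain ⟨_, ⟨⟨i, rfl⟩, xi⟩, _, ⟨⟨j, rfl⟩, xj⟩, hij⟩ := (Set.one_lt_ncard (Set.toFinite _)).1 hA
  obtain ⟨y₁, ⟨dy1, xy1⟩, y₂, ⟨dy2, xy2⟩, hy⟩ := (Set.one_lt_ncard (Set.toFinite _)).1 hB
  have hij' : i ≠ j := fun k => hij (by rw [k])
  have hx' : ∀ k, x ≠ c k := by
    rintro k rfl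
    have := distC_le (G := G) (c := c) (c k) k
    rw [SimpleGraph.dist_self] at this
    omega
  have ex : ∃ i, G.Adj x (c i) ∧ G.Adj x (c (i + 2)) := by
    have : j = i + 1 ∨ j = i + 2 ∨ i = j + 1 ∨ i = j + 2 := by
      clear * - hij'
      revert i j
      decide
    rcases this with rfl | rfl | rfl | rfl
    · exact (T xi (cadj i) xj).elim
    · exact ⟨i, xi, xj⟩
    · exact (T xj (cadj j) xi).elim
    · exact ⟨j, xj, xi⟩
  clear xi xj hij hij' i j hA hB
  obtain ⟨i, x0, x2⟩ := ex
  have h01 : G.Adj (c i) (c (i + 1)) := cadj i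
  have h12 : G.Adj (c (i + 1)) (c (i + 2)) := by
    have := cadj (i + 1); rwa [add_assoc] at this
  have h23 : G.Adj (c (i + 2)) (c (i + 3)) := by
    have := cadj (i + 2); rwa [add_assoc] at this
  have h34 : G.Adj (c (i + 3)) (c (i + 4)) := by
    have := cadj (i + 3); rwa [add_assoc] at this
  have h40 : G.Adj (c (i + 4)) (c i) := by
    have := cadj (i + 4)
    rwa [show i + 4 + 1 = i by clear * -; revert i; decide] at this
  have all : ∀ k : Fin 5, k = i ∨ k = i + 1 ∨ k = i + 2 ∨ k = i + 3 ∨ k = i + 4 := by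
    clear * -
    revert i; decide
  have n14 : c (i + 1) ≠ c (i + 4) := fun k => by
    have := cinj k; revert this; clear * -; revert i; decide
  have n13 : c (i + 1) ≠ c (i + 3) := fun k => by
    have := cinj k; revert this; clear * -; revert i; decide
  have n02 : c i ≠ c (i + 2) := fun k => by
    have := cinj k; revert this; clear * -; revert i; decide
  have i0 : i ≠ i + 1 := by clear * -; revert i; decide
  have i2 : i + 2 ≠ i + 1 := by clear * -; revert i; decide
  have i3 : i + 3 ≠ i + 1 := by clear * -; revert i; decide
  have i4 : i + 4 ≠ i + 1 := by clear * -; revert i; decide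
  -- the other cycle
  set d : Fin 5 → V := Function.update c (i + 1) x with hd
  have d1 : d (i + 1) = x := by simp [hd]
  have d0 : ∀ k, k ≠ i + 1 → d k = c k := fun k hk => by simp [hd, hk]
  have dC5 : IsC5 G d := by
    refine ⟨?_, ?_⟩
    · intro a b hab
      by_cases ha : a = i + 1
      · by_cases hb : b = i + 1
        · rw [ha, hb]
        · rw [ha, d1, d0 b hb] at hab
          exact (hx' _ hab).elim
      · by_cases hb : b = i + 1
        · rw [hb, d1, d0 a ha] at hab
          exact (hx' _ hab.symm).elim
        · rw [d0 a ha, d0 b hb] at hab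
          exact cinj hab
    · intro k
      rcases all k with rfl | rfl | rfl | rfl | rfl
      · rw [d1, d0 _ i0]; exact x0.symm
      · rw [d1, add_assoc, show (1 + 1 : Fin 5) = 2 from rfl, d0 _ i2]; exact x2
      · rw [add_assoc, show (2 + 1 : Fin 5) = 3 from rfl, d0 _ i2, d0 _ i3]; exact h23
      · rw [add_assoc, show (3 + 1 : Fin 5) = 4 from rfl, d0 _ i3, d0 _ i4]; exact h34
      · rw [add_assoc, show (4 + 1 : Fin 5) = 0 from rfl, add_zero, d0 _ i4, d0 _ i0]; exact h40
  have hle := hgood d dC5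
  set A : Set V := {u : V | 2 ≤ distC G c u} with hAdef
  set B : Set V := {u : V | 2 ≤ distC G d u} with hBdef
  have hAB : (A \ B).ncard ≤ (B \ A).ncard := by
    have e1 := Set.ncard_inter_add_ncard_sdiff_eq_ncard A B (Set.toFinite _)
    have e2 := Set.ncard_inter_add_ncard_sdiff_eq_ncard B A (Set.toFinite _)
    rw [Set.inter_comm] at e2
    omega
  have yB : ∀ y, G.Adj x y → y ∉ B := by
    intro y xy hyB
    exact not_adj_of_distC hyB (i + 1) (by rw [d1]; exact xy.symm)
  have h2 : 1 < (A \ B).ncard :=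
    (Set.one_lt_ncard (Set.toFinite _)).2
      ⟨y₁, ⟨dy1.ge, yB _ xy1⟩, y₂, ⟨dy2.ge, yB _ xy2⟩, hy⟩
  obtain ⟨p₁, hp1, p₂, hp2, hp⟩ := (Set.one_lt_ncard (Set.toFinite _)).1 (h2.trans_le hAB)
  have preach : ∀ p ∈ B \ A, G.Adj (c (i + 1)) p ∧
      ∀ v, v = c i ∨ v = x ∨ v = c (i + 2) ∨ v = c (i + 3) ∨ v = c (i + 4) → ¬ G.Adj p v := by
    rintro p ⟨pB, pA⟩
    have hn : ∀ v, v = c i ∨ v = x ∨ v = c (i + 2) ∨ v = c (i + 3) ∨ v = c (i + 4) →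
        ¬ G.Adj p v := by
      rintro v (rfl | rfl | rfl | rfl | rfl)
      · rw [← d0 _ i0]; exact not_adj_of_distC pB _
      · rw [← d1]; exact not_adj_of_distC pB _
      · rw [← d0 _ i2]; exact not_adj_of_distC pB _
      · rw [← d0 _ i3]; exact not_adj_of_distC pB _
      · rw [← d0 _ i4]; exact not_adj_of_distC pB _
    refine ⟨?_, hn⟩
    have hp0 : G.Reachable p (c i) := by
      by_contra k
      have h1 := distC_le (G := G) (c := d) p i
      rw [d0 _ i0, SimpleGraph.dist_eq_zero_of_not_reachable k] at h1
      have : 2 ≤ distC G d p := pB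
      omega
    have hreach : ∀ k, G.Reachable p (c k) := by
      intro k
      rcases all k with rfl | rfl | rfl | rfl | rfl
      · exact hp0
      · exact hp0.trans h01.reachable
      · exact hp0.trans (h01.reachable.trans h12.reachable)
      · exact hp0.trans (h40.symm.reachable.trans h34.symm.reachable)
      · exact hp0.trans h40.symm.reachable
    obtain ⟨k, hk⟩ := distC_exists (G := G) c p
    have hk1 : G.dist p (c k) ≤ 1 := by
      have : ¬ (2 ≤ distC G c p) := pA
      omega
    rcases Nat.le_one_iff_eq_zero_or_eq_one.1 hk1 with h0 | h1
    · have hpk : p = c k := (hreach k).dist_eq_zero_iff.1 h0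
      exfalso
      rcases all k with rfl | rfl | rfl | rfl | rfl
      · exact hn _ (Or.inr (Or.inr (Or.inr (Or.inr rfl)))) (hpk ▸ h40.symm)
      · exact hn _ (Or.inl rfl) (hpk ▸ h01.symm)
      · exact hn _ (Or.inr (Or.inr (Or.inr (Or.inl rfl)))) (hpk ▸ h23)
      · exact hn _ (Or.inr (Or.inr (Or.inl rfl))) (hpk ▸ h23.symm)
      · exact hn _ (Or.inl rfl) (hpk ▸ h40)
    · have hpk : G.Adj p (c k) := SimpleGraph.dist_eq_one_iff_adj.1 h1
      rcases all k with rfl | rfl | rfl | rfl | rfl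
      · exact (hn _ (by simp) hpk).elim
      · exact hpk.symm
      · exact (hn _ (by simp) hpk).elim
      · exact (hn _ (by simp) hpk).elim
      · exact (hn _ (by simp) hpk).elim
  obtain ⟨cp1, np1⟩ := preach p₁ hp1
  obtain ⟨cp2, np2⟩ := preach p₂ hp2
  have ny : ∀ y, distC G c y = 2 → ∀ v, v = c i ∨ v = c (i + 1) ∨ v = c (i + 2) ∨
      v = c (i + 3) ∨ v = c (i + 4) → ¬ G.Adj y v := by
    rintro y hy v (rfl | rfl | rfl | rfl | rfl) <;> exact not_adj_of_distC hy.ge _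
  have ny1 := ny y₁ dy1
  have ny2 := ny y₂ dy2
  have sy := side hG hy h01 h12 h23 h34 h40 n14 n13 n02 x0 x2 xy1 xy2 ny1 ny2
  have sp := side hG hp x0.symm x2 h23 h34 h40 (hx' _) (hx' _) n02 h01.symm h12 cp1 cp2 np1 np2
  rcases sy with ⟨z, a1, a2, a3, a4⟩ | ⟨z, a1, a2, a3, a4⟩ <;>
    rcases sp with ⟨w, b1, b2, b3, b4⟩ | ⟨w, b1, b2, b3, b4⟩
  · exact final hG.1 hG.2.1 hy hp h01 h12 h23 h34 h40 x0 x2 xy1 xy2 cp1 cp2 ny1 ny2 np1 np2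
      a1 a2 a3 a4 b1 b2 b3 b4
  · exact final hG.1 hG.2.1 hy hp.symm h01 h12 h23 h34 h40 x0 x2 xy1 xy2 cp2 cp1 ny1 ny2 np2 np1
      a1 a2 a3 a4 b1 b2 b3 b4
  · exact final hG.1 hG.2.1 hy.symm hp h01 h12 h23 h34 h40 x0 x2 xy2 xy1 cp1 cp2 ny2 ny1 np1 np2
      a1 a2 a3 a4 b1 b2 b3 b4
  · exact final hG.1 hG.2.1 hy.symm hp.symm h01 h12 h23 h34 h40 x0 x2 xy2 xy1 cp2 cp1 ny2 ny1
      np2 np1 a1 a2 a3 a4 b1 b2 b3 b4
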